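/- arXiv:1207.6333 — 3 statements merged into one kernel-verified Lean document; each statement's English description precedes it below -/
import Mathlib

section
/- Let k be a field of characteristic zero, A = k[x_1,…,x_n], f ∈ A with finite Milnor number, R a local Artinian k-algebra with maximal ideal 𝔪, and p ∈ 𝔪 ⊗ A. Then the complex (R ⊗_k Λ_A T_A, ad_{f-p}) (the Koszul complex on the partial derivatives of f−p with coefficients in R) is acyclic in positive degrees. -/
open MvPolynomial ExteriorAlgebra

namespace KoszulAux

lemma mem_smul_top_iff_coord {B E ι : Type*} [CommRing B] [AddCommGroup E] [Module B E]
    (b : Module.Basis ι B E) (I : Ideal B) (z : E) :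
    z ∈ I • (⊤ : Submodule B E) ↔ ∀ i, b.repr z i ∈ I := by
  constructor
  · intro hz i
    induction hz using Submodule.smul_induction_on' with
    | smul r hr m hm => simpa using I.mul_mem_right _ hr
    | add x hx y hy h1 h2 => simpa using I.add_mem h1 h2
  · intro h
    rw [← b.linearCombination_repr z, Finsupp.linearCombination_apply]
    exact Submodule.sum_mem _ fun i _ => Submodule.smul_mem_smul (h i) trivial

lemma linear_mem {B E E' : Type*} [CommRing B] [AddCommGroup E] [Module B E]
    [AddCommGroup E'] [Module B E'] (d : E →ₗ[B] E')
    (I : Ideal B) {z : E} (hz : z ∈ I • (⊤ : Submodule B E)) : d z ∈ I • (⊤ : Submodule B E') := by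
  have : d z ∈ (I • (⊤ : Submodule B E)).map d := ⟨z, hz, rfl⟩
  rw [Submodule.map_smul''] at this
  exact Submodule.smul_mono le_rfl le_top this

lemma contract_mem {B M : Type*} [CommRing B] [AddCommGroup M] [Module B M]
    (φ : Module.Dual B M) (q : ℕ) (x : ExteriorAlgebra B M) (hx : x ∈ ⋀[B]^(q+1) M) :
    CliffordAlgebra.contractLeft (Q := (0 : QuadraticForm B M)) φ x ∈ ⋀[B]^q M := by
  induction q generalizing x with
  | zero =>
    rw [exteriorPower, zero_add, pow_one] at hx
    obtain ⟨m, rfl⟩ := hx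
    rw [ExteriorAlgebra.ι, CliffordAlgebra.contractLeft_ι]
    rw [exteriorPower, pow_zero]
    exact Submodule.algebraMap_mem _
  | succ q ih =>
    rw [exteriorPower, pow_succ'] at hx
    induction hx using Submodule.mul_induction_on' with
    | mem_mul_mem m hm y hy =>
      obtain ⟨m, rfl⟩ := hm
      rw [ExteriorAlgebra.ι, CliffordAlgebra.contractLeft_ι_mul]
      refine sub_mem (Submodule.smul_mem _ _ hy) ?_
      rw [exteriorPower, pow_succ']
      exact Submodule.mul_mem_mul ⟨m, rfl⟩ (ih y hy)
    | add x hx y hy h1 h2 => rw [map_add]; exact add_mem h1 h2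

lemma koszul {B : Type*} [CommRing B] (n : ℕ) (φ : Module.Dual B (Fin n → B))
    (g : Fin n → B) (hg : ∀ i, ∃ v, φ v = g i)
    (hreg : ∀ i b, g i * b ∈ Ideal.span (g '' {j | j < i}) → b ∈ Ideal.span (g '' {j | j < i}))
    (s : ℕ) (hs : s ≤ n) :
    ∀ q, s < q → ∀ x ∈ ⋀[B]^q (Fin n → B),
      CliffordAlgebra.contractLeft (Q := (0 : QuadraticForm B (Fin n → B))) φ x ∈
        Ideal.span (g '' {j | j.val < s}) • (⊤ : Submodule B (ExteriorAlgebra B (Fin n → B))) →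
      ∃ y ∈ ⋀[B]^(q+1) (Fin n → B),
        x - CliffordAlgebra.contractLeft (Q := (0 : QuadraticForm B (Fin n → B))) φ y ∈
        Ideal.span (g '' {j | j.val < s}) • (⊤ : Submodule B (ExteriorAlgebra B (Fin n → B))) := by
  induction hs using Nat.decreasingInduction with
  | self =>
    intro q hq x hx _
    refine ⟨0, zero_mem _, ?_⟩
    have : x = 0 := by
      have b := (Pi.basisFun B (Fin n)).exteriorPower q
      have : IsEmpty (Set.powersetCard (Fin n) q) := by
        refine ⟨fun t => ?_⟩
        have h1 := t.2
        rw [Set.powersetCard.mem_iff] at h1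
        have := Finset.card_le_univ t.1
        simp at this
        omega
      have h := b.repr.injective (Subsingleton.elim (b.repr ⟨x, hx⟩) (b.repr 0))
      simpa using congrArg Subtype.val h
    simp [this]
  | of_succ s hs ih =>
    replace hs : s < n := hs
    intro q hq z hz hdz
    set d := CliffordAlgebra.contractLeft (Q := (0 : QuadraticForm B (Fin n → B))) φ with hd
    set I := Ideal.span (g '' {j | j.val < s}) with hI
    set a := g ⟨s, hs⟩ with ha
    have hI' : Ideal.span (g '' {j | j.val < s + 1}) = Ideal.span {a} ⊔ I := by
      rw [hI, ← Ideal.span_union, ha, ← Set.image_singleton, ← Set.image_union]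
      congr 2
      ext j
      simp [Fin.ext_iff]
      omega
    rw [hI'] at ih
    obtain ⟨v, hv⟩ := hg ⟨s, hs⟩
    have hdy : d (ExteriorAlgebra.ι B v * z) = a • z - ExteriorAlgebra.ι B v * d z := by
      rw [hd, ExteriorAlgebra.ι, CliffordAlgebra.contractLeft_ι_mul, hv]
    have hvz : ExteriorAlgebra.ι B v * d z ∈ I • (⊤ : Submodule B (ExteriorAlgebra B (Fin n → B))) :=
      linear_mem (LinearMap.mulLeft B (ExteriorAlgebra.ι B v)) I hdz
    have hy0 : ExteriorAlgebra.ι B v * z ∈ ⋀[B]^(q+1) (Fin n → B) := by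
      rw [exteriorPower, pow_succ']
      exact Submodule.mul_mem_mul ⟨v, rfl⟩ hz
    obtain ⟨w, hw, ht⟩ := ih (q+1) (by omega) _ hy0 (by
      rw [hdy, Submodule.sup_smul]
      refine sub_mem (Submodule.mem_sup_left ?_) (Submodule.mem_sup_right hvz)
      exact Submodule.smul_mem_smul (Ideal.mem_span_singleton_self a) trivial)
    have hth : ExteriorAlgebra.ι B v * z - d w ∈ ⋀[B]^(q+1) (Fin n → B) :=
      sub_mem hy0 (contract_mem φ _ _ hw)
    rw [Submodule.sup_smul, Submodule.mem_sup] at ht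
    obtain ⟨t1, ht1, t, ht, hsum⟩ := ht
    rw [Submodule.ideal_span_singleton_smul] at ht1
    obtain ⟨u, -, rfl⟩ := ht1
    change a • u + t = _ at hsum
    let P := GradedAlgebra.proj (fun i : ℕ ↦ ⋀[B]^i (Fin n → B)) (q+1)
    have hP : a • P u + P t = ExteriorAlgebra.ι B v * z - d w := by
      rw [← map_smul, ← map_add, hsum]
      exact DirectSum.decompose_of_mem_same (fun i : ℕ ↦ ⋀[B]^i (Fin n → B)) hth
    refine ⟨P u, SetLike.coe_mem _, ?_⟩
    have hPt : P t ∈ I • (⊤ : Submodule B (ExteriorAlgebra B (Fin n → B))) := linear_mem P I ht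
    have key : a • (z - d (P u)) ∈ I • (⊤ : Submodule B (ExteriorAlgebra B (Fin n → B))) := by
      have h := congrArg d hP
      rw [map_add, map_smul, map_sub, hdy, hd, CliffordAlgebra.contractLeft_contractLeft, ← hd,
        sub_zero] at h
      have : a • (z - d (P u)) = d (P t) + ExteriorAlgebra.ι B v * d z := by
        rw [smul_sub, sub_eq_iff_eq_add, add_right_comm, add_comm (d (P t)), h]; abel
      rw [this]
      exact add_mem (linear_mem d I hPt) hvz
    rw [mem_smul_top_iff_coord (Pi.basisFun B (Fin n)).ExteriorAlgebra] at key ⊢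
    intro i
    refine hreg ⟨s, hs⟩ _ ?_
    have := key i
    rwa [map_smul, Finsupp.smul_apply, smul_eq_mul] at this

lemma reg_poly {C : Type*} [CommRing C] (I : Ideal C) (h : Polynomial C) (hm : h.Monic)
    (b : Polynomial C) (hb : h * b ∈ I.map Polynomial.C) : b ∈ I.map Polynomial.C := by
  rw [← Ideal.mk_ker (I := I), ← Polynomial.ker_mapRingHom, RingHom.mem_ker] at hb ⊢
  rw [map_mul] at hb
  exact (hm.map (Ideal.Quotient.mk I)).isRegular.left (by simpa using hb)

lemma mem_equiv {A B : Type*} [CommRing A] [CommRing B] (e : A ≃+* B) (I : Ideal A) (J : Ideal B)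
    (h : I.map (e : A →+* B) = J) (c : A) : c ∈ I ↔ e c ∈ J := by
  rw [← h]
  constructor
  · exact fun hc => Ideal.mem_map_of_mem (e : A →+* B) hc
  · intro hc
    obtain ⟨x, hx, hxe⟩ := (Ideal.mem_map_of_equiv e _).1 hc
    exact e.injective hxe ▸ hx

lemma reg_mv {σ R : Type*} [CommRing R] [DecidableEq σ] (h : σ → Polynomial R)
    (hm : ∀ i, (h i).Monic) (i : σ) (S : Set σ) (hS : i ∉ S) (b : MvPolynomial σ R)
    (hb : Polynomial.aeval (X i : MvPolynomial σ R) (h i) * b ∈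
      Ideal.span ((fun j => Polynomial.aeval (X j : MvPolynomial σ R) (h j)) '' S)) :
    b ∈ Ideal.span ((fun j => Polynomial.aeval (X j : MvPolynomial σ R) (h j)) '' S) := by
  obtain ⟨e, hei, hej⟩ : ∃ e : MvPolynomial σ R ≃ₐ[R] Polynomial (MvPolynomial {j // j ≠ i} R),
      e (X i) = Polynomial.X ∧ ∀ j (hj : j ≠ i), e (X j) = Polynomial.C (X ⟨j, hj⟩) := by
    refine ⟨(renameEquiv R (Equiv.optionSubtypeNe i).symm).trans (optionEquivLeft R _), ?_, ?_⟩
    · simp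
    · intro j hj
      simp [Equiv.optionSubtypeNe_symm_of_ne hj]
  let I : Ideal (MvPolynomial {j // j ≠ i} R) :=
    Ideal.span ((fun j => Polynomial.aeval (X j) (h j.1)) '' {j | j.1 ∈ S})
  have hI : (Ideal.span ((fun j => Polynomial.aeval (X j : MvPolynomial σ R) (h j)) '' S)).map
      (e : MvPolynomial σ R →+* Polynomial (MvPolynomial {j // j ≠ i} R)) = I.map Polynomial.C := by
    rw [Ideal.map_span, Ideal.map_span]
    congr 1
    ext t
    simp only [Set.mem_image, exists_exists_and_eq_and, Set.mem_ofPred_eq]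
    have hh : ∀ j (hj : j ≠ i), e (Polynomial.aeval (X j) (h j)) =
        Polynomial.C (Polynomial.aeval (X ⟨j, hj⟩) (h j)) := by
      intro j hj
      rw [← Polynomial.aeval_algHom_apply, hej j hj, ← Polynomial.CAlgHom_apply (R := R), Polynomial.aeval_algHom_apply]
      rfl
    constructor
    · rintro ⟨j, hj, rfl⟩
      have hji : j ≠ i := fun h => hS (h ▸ hj)
      exact ⟨⟨j, hji⟩, hj, (hh j hji).symm⟩
    · rintro ⟨⟨j, hji⟩, hj, rfl⟩
      exact ⟨j, hj, hh j hji⟩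
  have hmem : ∀ c, c ∈ Ideal.span ((fun j => Polynomial.aeval (X j : MvPolynomial σ R) (h j)) '' S)
      ↔ e c ∈ I.map Polynomial.C := by
    intro c
    exact mem_equiv e.toRingEquiv _ _ hI c
  rw [hmem] at hb ⊢
  rw [map_mul, ← Polynomial.aeval_algHom_apply, hei] at hb
  rw [← Polynomial.aeval_map_algebraMap (MvPolynomial {j // j ≠ i} R) Polynomial.X (h i),
    Polynomial.aeval_X_left_apply] at hb
  exact reg_poly I _ ((hm i).map _) (e b) hb

end KoszulAux

/-- Let `k` be a field of characteristic zero, `A = k[x₁,…,xₙ]`, `f ∈ A`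
with finite Milnor number, `R` a local Artinian `k`-algebra with maximal ideal `𝔪`, and
`p ∈ 𝔪 ⊗ A` (modeled as a polynomial in `R[x₁,…,xₙ] = R ⊗ₖ A` all of whose coefficients
lie in `𝔪`).  Then the complex `(R ⊗ₖ Λ_A T_A, ad_{f−p})` — the Koszul complex on the
partial derivatives of `f − p` with coefficients in `R`, realized as the exterior algebra
on `(R ⊗ₖ A)ⁿ` with the contraction differential `eᵢ ↦ ∂ᵢ(f − p)` — is acyclic in
positive degrees. -/
theorem unfolding_stmt9 (k : Type*) [Field k] [CharZero k] (n : ℕ)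
    (f : MvPolynomial (Fin n) k)
    (hμ : FiniteDimensional k
      (MvPolynomial (Fin n) k ⧸
        Ideal.span (Set.range fun i : Fin n => pderiv i f)))
    (R : Type*) [CommRing R] [Algebra k R] [IsArtinianRing R] [IsLocalRing R]
    (p : MvPolynomial (Fin n) R)
    (hp : ∀ m, p.coeff m ∈ IsLocalRing.maximalIdeal R) :
    let AR := MvPolynomial (Fin n) R
    let F : AR := MvPolynomial.map (algebraMap k R) f
    let φ : Module.Dual AR (Fin n → AR) :=
      ∑ i : Fin n, pderiv i (F - p) • LinearMap.proj i
    let d : ExteriorAlgebra AR (Fin n → AR) →ₗ[AR] ExteriorAlgebra AR (Fin n → AR) :=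
      CliffordAlgebra.contractLeft φ
    ∀ q : ℕ, 0 < q → ∀ x ∈ ⋀[AR]^q (Fin n → AR), d x = 0 →
      ∃ y ∈ ⋀[AR]^(q + 1) (Fin n → AR), d y = x := by
  intro AR F φ d q hq x hx hdx
  have hint : ∀ i : Fin n, ∃ h : Polynomial k, h.Monic ∧ Polynomial.aeval (X i) h ∈
      Ideal.span (Set.range fun i : Fin n => pderiv i f) := by
    intro i
    obtain ⟨h, hm, h0⟩ := Algebra.IsIntegral.isIntegral (R := k)
      (Ideal.Quotient.mk (Ideal.span (Set.range fun i : Fin n => pderiv i f)) (X i))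
    refine ⟨h, hm, ?_⟩
    rw [← Ideal.Quotient.eq_zero_iff_mem]
    rw [← Polynomial.aeval_def, ← Ideal.Quotient.mkₐ_eq_mk k, Polynomial.aeval_algHom_apply] at h0
    exact h0
  choose h hm hJ using hint
  obtain ⟨N, hN⟩ := IsArtinianRing.isNilpotent_jacobson_bot (R := R)
  rw [IsLocalRing.jacobson_eq_maximalIdeal ⊥ bot_ne_top] at hN
  let J : Ideal AR := Ideal.span (Set.range fun i : Fin n => pderiv i (F - p))
  let 𝔐 : Ideal AR := (IsLocalRing.maximalIdeal R).map C
  have hle : (Ideal.span (Set.range fun i : Fin n => pderiv i f)).map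
      (MvPolynomial.map (algebraMap k R)) ≤ J ⊔ 𝔐 := by
    rw [Ideal.map_span, Ideal.span_le]
    rintro _ ⟨_, ⟨i, rfl⟩, rfl⟩
    have : MvPolynomial.map (algebraMap k R) (pderiv i f) = pderiv i (F - p) + pderiv i p := by
      rw [map_sub, sub_add_cancel, pderiv_map]
    change MvPolynomial.map (algebraMap k R) (pderiv i f) ∈ J ⊔ 𝔐
    rw [this]
    refine add_mem (Ideal.mem_sup_left (Ideal.subset_span ⟨i, rfl⟩)) (Ideal.mem_sup_right ?_)
    refine MvPolynomial.mem_map_C_iff.2 fun m => ?_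
    rw [coeff_pderiv]
    exact Ideal.mul_mem_right _ _ (hp _)
  let H : Fin n → Polynomial R := fun i => ((h i).map (algebraMap k R)) ^ (1 + N)
  let g : Fin n → AR := fun i => Polynomial.aeval (X i : AR) (H i)
  have hgJ : ∀ i, g i ∈ J := by
    intro i
    have h1 : Polynomial.aeval (X i : AR) ((h i).map (algebraMap k R)) ∈ J ⊔ 𝔐 := by
      apply hle
      have := Ideal.mem_map_of_mem (MvPolynomial.map (σ := Fin n) (algebraMap k R)) (hJ i)
      convert this using 1
      rw [Polynomial.aeval_map_algebraMap, Polynomial.aeval_def, Polynomial.aeval_def,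
        Polynomial.hom_eval₂, MvPolynomial.map_X]
      congr 1
      ext c
      simp [MvPolynomial.algebraMap_apply]
    have h2 : g i ∈ (J ⊔ 𝔐) ^ (1 + N) := by
      simp only [g, H, map_pow]
      exact Ideal.pow_mem_pow h1 _
    have h3 : (J ⊔ 𝔐) ^ (1 + N) ≤ J ⊔ 𝔐 ^ N := by
      have := Ideal.sup_pow_add_le_pow_sup_pow (I := J) (J := 𝔐) (n := 1) (m := N)
      rwa [pow_one] at this
    have h4 : 𝔐 ^ N = ⊥ := by
      rw [← Ideal.map_pow, hN]; exact Ideal.map_bot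
    have := h3 h2
    rwa [h4, sup_bot_eq] at this
  have hφ : ∀ v, φ v = ∑ i, pderiv i (F - p) * v i := by
    intro v; simp [φ]
  obtain ⟨y, hy, hxy⟩ := KoszulAux.koszul n φ g (fun i => by
      obtain ⟨c, hc⟩ := (Ideal.mem_span_range_iff_exists_fun).1 (hgJ i)
      exact ⟨c, by rw [hφ, ← hc]; exact Finset.sum_congr rfl fun _ _ => mul_comm _ _⟩)
    (fun i b hb => KoszulAux.reg_mv H (fun i => ((hm i).map _).pow _) i _ (by simp) b hb)
    0 (Nat.zero_le _) q hq x hx (by rw [show _ = (0 : ExteriorAlgebra AR (Fin n → AR)) from hdx]; exact zero_mem _)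
  refine ⟨y, hy, ?_⟩
  simp only [Nat.not_lt_zero, Set.ofPred_false, Set.image_empty, Ideal.span_empty, Submodule.bot_smul, Submodule.mem_bot] at hxy
  exact (sub_eq_zero.1 hxy).symm
end

section
/- Let k be a field of characteristic zero, A = k[x_1,…,x_n], f ∈ A with finite Milnor number, R local Artinian with maximal ideal 𝔪, p ∈ 𝔪 ⊗ A, and S ∈ 𝔪 ⊗ Λ²_A T_A a bivector. Then [f − p, S] = 0 if and only if there exists a trivector field T ∈ 𝔪 ⊗ Λ³_A T_A with S = [f − p, T]. -/
open MvPolynomial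

/- Polyvector fields on affine `n`-space in coordinates.  Since `T_A = Der_k(A)` is free on
`∂₁, …, ∂ₙ`, a `p`-vector field is given by its alternating array of coefficients.  The
Schouten–Nijenhuis bracket is given by the classical coordinate formulas below. -/

variable {k : Type*} [CommRing k] {n : ℕ}

/-- The coefficients of the Schouten bracket `[g, S]` (contraction of the bivector `S` with
`dg`): `[g,S]_j = ∑ᵢ S i j ∂ᵢ g`.  It is a vector field. -/
noncomputable def schFnBiv (g : MvPolynomial (Fin n) k)
    (S : Fin n → Fin n → MvPolynomial (Fin n) k) : Fin n → MvPolynomial (Fin n) k :=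
  fun j => ∑ i, S i j * pderiv i g

/-- The coefficients of the Schouten bracket `[g, T]` of a function with a trivector `T`
(contraction with `dg`): it is a bivector, `[g,T]_{jk} = ∑ᵢ T i j k ∂ᵢ g`. -/
noncomputable def schFnTriv (g : MvPolynomial (Fin n) k)
    (T : Fin n → Fin n → Fin n → MvPolynomial (Fin n) k) :
    Fin n → Fin n → MvPolynomial (Fin n) k :=
  fun j l => ∑ i, T i j l * pderiv i g

/-- The coefficients of the Schouten bracket `[S, S]` of a bivector with itself; it is a
trivector with components `[S,S]^{ijk} = 2 ∑ₗ (S l i ∂ₗ S j k + S l j ∂ₗ S k i + S l k ∂ₗ S i j)`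
(we drop the overall factor 2, harmless in characteristic zero). -/
noncomputable def schBivBiv (S : Fin n → Fin n → MvPolynomial (Fin n) k) :
    Fin n → Fin n → Fin n → MvPolynomial (Fin n) k :=
  fun i j l => ∑ m, (S m i * pderiv m (S j l) + S m j * pderiv m (S l i) +
    S m l * pderiv m (S i j))

/-- A trivector array is alternating. -/
def IsAltTriv (T : Fin n → Fin n → Fin n → MvPolynomial (Fin n) k) : Prop :=
  ∀ i j l, T i j l = - T j i l ∧ T i j l = - T i l j

/-- A bivector array is antisymmetric. -/
def IsAltBiv (S : Fin n → Fin n → MvPolynomial (Fin n) k) : Prop :=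
  ∀ i j, S i j = - S j i


section Koszul
variable {B : Type*} [CommRing B] {V : Type*} [AddCommGroup V] [Module B V]

lemma kz_homotopy {M : Type*} [AddCommGroup M] [Module B M] {j : ℕ} (φ : V →ₗ[B] B) (g : V)
    (c : V [⋀^Fin (j+1)]→ₗ[B] M) (hc : c.curryLeft g = 0) :
    (AlternatingMap.alternatizeUncurryFin (φ.smulRight c)).curryLeft g = φ g • c := by
  ext v
  rw [AlternatingMap.curryLeft_apply_apply, AlternatingMap.alternatizeUncurryFin_apply,
    Fin.sum_univ_succ, Finset.sum_eq_zero]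
  · simp [Matrix.vecCons]
  · intro a _
    have h : a.succ.removeNth (Matrix.vecCons g v) = Matrix.vecCons g (a.removeNth v) := by
      ext b
      refine Fin.cases ?_ (fun b => ?_) b <;> simp [Fin.removeNth]
    have h2 := congrArg (fun t => t (a.removeNth v)) hc
    simp only [AlternatingMap.curryLeft_apply_apply, AlternatingMap.zero_apply] at h2
    simp [h, h2]

lemma kz_lift [Module.Free B V] {M N : Type*} [AddCommGroup M] [Module B M] [AddCommGroup N]
    [Module B N] (π : M →ₗ[B] N) (hπ : Function.Surjective π) {j : ℕ}
    (c : V [⋀^Fin j]→ₗ[B] N) : ∃ c' : V [⋀^Fin j]→ₗ[B] M, π.compAlternatingMap c' = c := by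
  obtain ⟨h, hh⟩ := Module.projective_lifting_property π
    (exteriorPower.alternatingMapLinearEquiv c) hπ
  refine ⟨exteriorPower.alternatingMapLinearEquiv.symm h, ?_⟩
  ext v
  have := congrArg (fun t => t (exteriorPower.ιMulti B j v)) hh
  simpa using this

theorem kz_exact {n : ℕ} (b : Module.Basis (Fin n) B V) (g : V) :
    ∀ (ys : List B) (M : Type*) [AddCommGroup M] [Module B M],
    RingTheory.Sequence.IsWeaklyRegular M ys →
    (∀ y ∈ ys, ∃ φ : V →ₗ[B] B, φ g = y) → ∀ j : ℕ, n < j + 1 + ys.length →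
    ∀ z : V [⋀^Fin (j+1)]→ₗ[B] M, z.curryLeft g = 0 →
      ∃ w : V [⋀^Fin (j+2)]→ₗ[B] M, w.curryLeft g = z := by
  have : Module.Free B V := Module.Free.of_basis b
  intro ys
  induction ys with
  | nil =>
    intro M _ _ _ _ j hj z hz
    refine ⟨0, ?_⟩
    refine Module.Basis.ext_alternating b fun v hv => ?_
    have := Fintype.card_le_of_injective v hv
    simp at this hj
    omega
  | cons y ys ih =>
    intro M _ _ hreg hy j hj z hz
    rw [RingTheory.Sequence.isWeaklyRegular_cons_iff] at hreg
    obtain ⟨hy0, hreg⟩ := hreg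
    obtain ⟨φ, hφ⟩ := hy y (by simp)
    let w := AlternatingMap.alternatizeUncurryFin (φ.smulRight z)
    have hw : w.curryLeft g = y • z := by rw [← hφ]; exact kz_homotopy φ g z hz
    let π : M →ₗ[B] QuotSMulTop y M := Submodule.mkQ _
    have hπ : Function.Surjective π := Submodule.mkQ_surjective _
    have hπy : ∀ x : M, π x = 0 ↔ ∃ x', y • x' = x := by
      intro x
      simp only [π, Submodule.mkQ_apply, Submodule.Quotient.mk_eq_zero]
      rw [Submodule.mem_smul_pointwise_iff_exists]
      simp
    obtain ⟨u, hu⟩ := ih (QuotSMulTop y M) hreg (fun y' h => hy y' (by simp [h])) (j+1)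
      (by simp at hj; omega) (π.compAlternatingMap w) (by
        rw [AlternatingMap.curryLeft_compAlternatingMap, hw]
        ext v
        simp only [LinearMap.compAlternatingMap_apply, AlternatingMap.smul_apply,
          AlternatingMap.zero_apply]
        exact (hπy _).2 ⟨_, rfl⟩)
    obtain ⟨u', rfl⟩ := kz_lift π hπ u
    have hd : ∀ v, ∃ x', y • x' = (w - u'.curryLeft g) v := by
      intro v
      rw [← hπy]
      have := congrArg (fun t => t v) hu
      rw [AlternatingMap.curryLeft_compAlternatingMap] at this
      simp only [LinearMap.compAlternatingMap_apply] at this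
      rw [AlternatingMap.sub_apply, map_sub, this, sub_self]
    choose q hq using hd
    have hinj : ∀ a b : M, y • a = y • b → a = b := fun a b h => hy0 h
    let t : V [⋀^Fin (j+2)]→ₗ[B] M :=
      { toFun := q
        map_update_add' := by
          intro _ v i x x'
          apply hinj
          rw [smul_add, hq, hq, hq, AlternatingMap.map_update_add]
        map_update_smul' := by
          intro _ v i c x
          apply hinj
          rw [smul_comm, hq, hq, AlternatingMap.map_update_smul]
        map_eq_zero_of_eq' := by
          intro v i j' h hne
          apply hinj
          rw [hq, smul_zero, AlternatingMap.map_eq_zero_of_eq _ v h hne] }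
    have ht : y • t = w - u'.curryLeft g := by
      ext v; exact hq v
    refine ⟨t, ?_⟩
    ext v
    apply hinj
    have h1 : (y • t).curryLeft g = y • z := by
      rw [ht, ← hw]
      ext v
      have := congrArg (fun t => t v) (AlternatingMap.curryLeft_same u' g)
      simp only [AlternatingMap.curryLeft_apply_apply, AlternatingMap.zero_apply] at this
      simp only [AlternatingMap.curryLeft_apply_apply, AlternatingMap.sub_apply, this, sub_zero]
    exact congrArg (fun t => t v) h1

end Koszul

section Reg
variable {R : Type*} [CommRing R] {m : ℕ}

noncomputable def isoAt (i : Fin m) : MvPolynomial (Fin m) R ≃ₐ[R]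
    Polynomial (MvPolynomial {j : Fin m // j ≠ i} R) :=
  (renameEquiv R (Equiv.optionSubtypeNe i).symm).trans (optionEquivLeft R _)

lemma isoAt_self (i : Fin m) : isoAt (R := R) i (X i) = Polynomial.X := by
  simp [isoAt]

lemma isoAt_ne (i j : Fin m) (h : j ≠ i) : isoAt (R := R) i (X j) = Polynomial.C (X ⟨j, h⟩) := by
  simp [isoAt, Equiv.optionSubtypeNe_symm_of_ne h]

def Indep (i : Fin m) (I : Ideal (MvPolynomial (Fin m) R)) : Prop :=
  ∃ I' : Ideal (MvPolynomial {j : Fin m // j ≠ i} R),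
    I.map (isoAt (R := R) i) = I'.map Polynomial.C

lemma Indep.mul {i : Fin m} {I J : Ideal (MvPolynomial (Fin m) R)} (hI : Indep i I)
    (hJ : Indep i J) : Indep i (I * J) := by
  obtain ⟨I', hI⟩ := hI
  obtain ⟨J', hJ⟩ := hJ
  exact ⟨I' * J', by rw [Ideal.map_mul, Ideal.map_mul, hI, hJ]⟩

lemma Indep.span {i : Fin m} {s : Set (MvPolynomial (Fin m) R)}
    (h : ∀ a ∈ s, ∃ w, isoAt i a = Polynomial.C w) : Indep i (Ideal.span s) := by
  choose! w hw using h
  refine ⟨Ideal.span (w '' s), ?_⟩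
  rw [Ideal.map_span, Ideal.map_span, Set.image_image]
  exact congrArg _ (Set.image_congr hw)

lemma Indep.reg {i : Fin m} {I : Ideal (MvPolynomial (Fin m) R)} (h : Indep i I)
    (q : Polynomial R) (hq : q.Monic) (P : MvPolynomial (Fin m) R)
    (hP : Polynomial.aeval (X i : MvPolynomial (Fin m) R) q * P ∈ I) : P ∈ I := by
  obtain ⟨I', hI⟩ := h
  have key : ∀ a, a ∈ I ↔ isoAt i a ∈ I'.map (Polynomial.C) := by
    intro a
    rw [← hI]
    constructor
    · intro h; exact Ideal.mem_map_of_mem _ h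
    · intro h
      rw [Ideal.mem_map_iff_of_surjective _ (isoAt i).surjective] at h
      obtain ⟨x, hx, hxa⟩ := h
      rwa [← (isoAt i).injective hxa]
  have key2 : ∀ a, a ∈ I'.map (Polynomial.C) ↔ Polynomial.map (Ideal.Quotient.mk I') a = 0 := by
    intro a
    rw [Ideal.mem_map_C_iff]
    simp only [Polynomial.ext_iff, Polynomial.coeff_map, Polynomial.coeff_zero,
      Ideal.Quotient.eq_zero_iff_mem]
  rw [key, key2] at hP ⊢
  rw [map_mul, Polynomial.map_mul, ← AlgEquiv.coe_toAlgHom, ← Polynomial.aeval_algHom_apply,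
    AlgEquiv.coe_toAlgHom, isoAt_self] at hP
  have hm : (Polynomial.map (Ideal.Quotient.mk I') (Polynomial.aeval
      (Polynomial.X : Polynomial (MvPolynomial {j : Fin m // j ≠ i} R)) q)).Monic := by
    rw [Polynomial.aeval_X_left_eq_map]
    exact (hq.map _).map _
  exact hm.isRegular.left (by simpa using hP)

lemma weaklyReg (𝔞 : Ideal R) (Q : Fin m → Polynomial R) (hQ : ∀ i, (Q i).Monic) :
    RingTheory.Sequence.IsWeaklyRegular (𝔞.map (C : R →+* MvPolynomial (Fin m) R))
      (List.ofFn fun i => Polynomial.aeval (X i : MvPolynomial (Fin m) R) (Q i)) := by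
  refine ⟨fun i hi => ?_⟩
  have him : i < m := by simpa using hi
  rw [isSMulRegular_iff_right_eq_zero_of_smul]
  intro x hx
  obtain ⟨x, rfl⟩ := Submodule.mkQ_surjective _ x
  rw [← map_smul] at hx
  rw [Submodule.mkQ_apply, Submodule.Quotient.mk_eq_zero, Submodule.mem_smul_top_iff] at hx ⊢
  simp only [List.getElem_ofFn, Submodule.coe_smul, smul_eq_mul] at hx ⊢
  refine Indep.reg (i := ⟨i, him⟩) (Indep.mul ?_ ?_) (Q ⟨i, him⟩) (hQ _) _ hx
  · refine Indep.span ?_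
    intro a ha
    simp only [Set.mem_ofPred_eq, List.mem_take_iff_getElem, List.getElem_ofFn] at ha
    obtain ⟨l, hl, rfl⟩ := ha
    have hne : (⟨l, by simp at hl; omega⟩ : Fin m) ≠ ⟨i, him⟩ := by
      simp at hl ⊢; omega
    refine ⟨Polynomial.aeval (X ⟨_, hne⟩) (Q ⟨l, by simp at hl; omega⟩), ?_⟩
    rw [← AlgEquiv.coe_toAlgHom, ← Polynomial.aeval_algHom_apply,
      AlgEquiv.coe_toAlgHom, isoAt_ne _ _ hne]
    exact Polynomial.aeval_algebraMap_apply _ _ _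
  · refine Indep.span ?_
    rintro _ ⟨r, _, rfl⟩
    refine ⟨C r, ?_⟩
    exact (isoAt _).commutes r

end Reg

section Main

lemma monicMem {K : Type*} [Field K] {m : ℕ}
    (f : MvPolynomial (Fin m) K)
    (hμ : FiniteDimensional K
      (MvPolynomial (Fin m) K ⧸
        Ideal.span (Set.range fun i : Fin m => pderiv i f)))
    (R : Type*) [CommRing R] [Algebra K R] [IsArtinianRing R] [IsLocalRing R]
    (p : MvPolynomial (Fin m) R)
    (hp : ∀ c, p.coeff c ∈ IsLocalRing.maximalIdeal R) (i : Fin m) :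
    ∃ Q : Polynomial R, Q.Monic ∧ Polynomial.aeval (X i : MvPolynomial (Fin m) R) Q ∈
      Ideal.span (Set.range fun i : Fin m =>
        pderiv i (MvPolynomial.map (algebraMap K R) f - p)) := by
  set I := Ideal.span (Set.range fun i : Fin m => pderiv i f) with hI
  set J := Ideal.span (Set.range fun i : Fin m =>
        pderiv i (MvPolynomial.map (algebraMap K R) f - p)) with hJ
  obtain ⟨q, hq, hq0⟩ := Algebra.IsIntegral.isIntegral (R := K)
    (Ideal.Quotient.mk I (X i))
  have hqI : Polynomial.aeval (X i : MvPolynomial (Fin m) K) q ∈ I := by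
    rw [← Ideal.Quotient.eq_zero_iff_mem, ← hq0, ← Polynomial.aeval_def]
    exact (Polynomial.aeval_algHom_apply (Ideal.Quotient.mkₐ K I) (X i) q).symm
  have hmap : MvPolynomial.map (algebraMap K R) (Polynomial.aeval (X i) q) =
      Polynomial.aeval (X i : MvPolynomial (Fin m) R) (q.map (algebraMap K R)) := by
    rw [Polynomial.aeval_def, Polynomial.aeval_def, Polynomial.hom_eval₂, Polynomial.eval₂_map]
    congr 1
    · ext; simp [MvPolynomial.algebraMap_eq]
    · simp
  have hle : I ≤ (J ⊔ (IsLocalRing.maximalIdeal R).map C).comap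
      (MvPolynomial.map (algebraMap K R)) := by
    rw [hI, Ideal.span_le]
    rintro _ ⟨a, rfl⟩
    simp only [SetLike.mem_coe, Ideal.mem_comap]
    have : MvPolynomial.map (algebraMap K R) (pderiv a f) =
        pderiv a (MvPolynomial.map (algebraMap K R) f - p) + pderiv a p := by
      rw [map_sub, sub_add_cancel, pderiv_map]
    rw [this]
    refine Submodule.add_mem_sup (Ideal.subset_span ⟨a, rfl⟩) ?_
    rw [MvPolynomial.mem_map_C_iff]
    intro c
    rw [MvPolynomial.coeff_pderiv]
    exact Ideal.mul_mem_right _ _ (hp _)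
  obtain ⟨u, hu, w, hw, huw⟩ := Submodule.mem_sup.1 (hle hqI)
  rw [hmap] at huw
  have hwn : IsNilpotent w := by
    rw [MvPolynomial.isNilpotent_iff]
    intro c
    rw [MvPolynomial.mem_map_C_iff] at hw
    have h1 := IsArtinianRing.isNilpotent_jacobson_bot (R := R)
    rw [IsLocalRing.jacobson_eq_maximalIdeal _ bot_ne_top] at h1
    obtain ⟨N, hN⟩ := h1
    refine ⟨N, ?_⟩
    have := Ideal.pow_mem_pow (hw c) N
    rw [hN] at this
    simpa using this
  obtain ⟨N, hN⟩ := hwn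
  refine ⟨(q.map (algebraMap K R)) ^ N, (hq.map _).pow _, ?_⟩
  rw [map_pow, ← huw, ← Ideal.Quotient.eq_zero_iff_mem, map_pow, map_add,
    Ideal.Quotient.eq_zero_iff_mem.2 hu, zero_add, ← map_pow, hN, map_zero]

end Main

lemma eq_zero_of_self_eq_neg (K : Type*) [Field K] [CharZero K] {E : Type*} [AddCommGroup E]
    [Module K E] (x : E) (h : x = -x) : x = 0 := by
  have h2 : (2 : K) • x = 0 := by
    rw [two_smul]; nth_rw 2 [h]; simp
  exact (smul_eq_zero.1 h2).resolve_left two_ne_zero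

noncomputable def altOfArr {B : Type*} [CommRing B] {M : Type*} [AddCommGroup M] [Module B M]
    {m : ℕ} (s : Fin m → Fin m → M) (hs : ∀ i j, s i j = - s j i) (hs0 : ∀ i, s i i = 0) :
    (Fin m → B) [⋀^Fin 2]→ₗ[B] M where
  toFun v := ∑ i, ∑ j, (v 0 i * v 1 j) • s i j
  map_update_add' := by
    intro _ v a x y
    fin_cases a <;> simp [Function.update, add_mul, mul_add, add_smul, Finset.sum_add_distrib]
  map_update_smul' := by
    intro _ v a c x
    fin_cases a
    · simp [Function.update, Finset.smul_sum, smul_smul, mul_assoc]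
    · simp only [Function.update, Finset.smul_sum, smul_smul]
      refine Finset.sum_congr rfl fun i _ => Finset.sum_congr rfl fun j _ => ?_
      simp [mul_left_comm]
  map_eq_zero_of_eq' := by
    intro v a b hab hne
    have h : v 0 = v 1 := by
      fin_cases a <;> fin_cases b
      · exact absurd rfl hne
      · exact hab
      · exact hab.symm
      · exact absurd rfl hne
    rw [h, ← Finset.sum_product']
    refine Finset.sum_involution (fun q _ => (q.2, q.1)) ?_ ?_ ?_ ?_
    · rintro ⟨i, j⟩ _
      simp only
      rw [hs i j, mul_comm]; simp
    · rintro ⟨i, j⟩ _ h1 h2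
      simp only [Prod.mk.injEq] at h2
      apply h1
      rw [h2.1, hs0, smul_zero]
    · simp
    · simp

lemma alt3_swap {B V M : Type*} [CommRing B] [AddCommGroup V] [Module B V] [AddCommGroup M]
    [Module B M] (w : V [⋀^Fin 3]→ₗ[B] M) (a b c : V) :
    w ![a, b, c] = - w ![b, a, c] ∧ w ![a, b, c] = - w ![a, c, b] := by
  constructor
  · rw [← w.map_swap ![b, a, c] (i := 0) (j := 1) (by decide)]
    congr 1
    ext1 x
    fin_cases x <;> rfl
  · rw [← w.map_swap ![a, c, b] (i := 1) (j := 2) (by decide)]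
    congr 1
    ext1 x
    fin_cases x <;> rfl

/-- Let `k` be a field of characteristic zero, `A = k[x₁,…,xₙ]`, `f ∈ A`
with finite Milnor number, `R` a local Artinian `k`-algebra with maximal ideal `𝔪`,
`p ∈ 𝔪 ⊗ A` and `S ∈ 𝔪 ⊗ Λ²_A T_A` a bivector (both modeled by coefficients in
`R[x₁,…,xₙ] = R ⊗ₖ A` lying in `𝔪`).  Then `[f − p, S] = 0` if and only if there is a
trivector field `T ∈ 𝔪 ⊗ Λ³_A T_A` with `S = [f − p, T]` (Schouten brackets, written in
coordinates via contraction with `d(f−p)`). -/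
theorem unfolding_stmt10 (K : Type*) [Field K] [CharZero K] (m : ℕ)
    (f : MvPolynomial (Fin m) K)
    (hμ : FiniteDimensional K
      (MvPolynomial (Fin m) K ⧸
        Ideal.span (Set.range fun i : Fin m => pderiv i f)))
    (R : Type*) [CommRing R] [Algebra K R] [IsArtinianRing R] [IsLocalRing R]
    (p : MvPolynomial (Fin m) R)
    (hp : ∀ c, p.coeff c ∈ IsLocalRing.maximalIdeal R)
    (S : Fin m → Fin m → MvPolynomial (Fin m) R) (hSalt : IsAltBiv S)
    (hSm : ∀ i j c, (S i j).coeff c ∈ IsLocalRing.maximalIdeal R) :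
    (∀ j, schFnBiv (MvPolynomial.map (algebraMap K R) f - p) S j = 0) ↔
      ∃ T : Fin m → Fin m → Fin m → MvPolynomial (Fin m) R,
        IsAltTriv T ∧
        (∀ i j l c, (T i j l).coeff c ∈ IsLocalRing.maximalIdeal R) ∧
        ∀ j l, S j l = schFnTriv (MvPolynomial.map (algebraMap K R) f - p) T j l := by
  constructor
  · intro h
    have hS0 : ∀ i, S i i = 0 := fun i => eq_zero_of_self_eq_neg K _ (hSalt i i)
    set g := MvPolynomial.map (algebraMap K R) f - p with hg
    let 𝔪 := (IsLocalRing.maximalIdeal R).map (C : R →+* MvPolynomial (Fin m) R)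
    let s : Fin m → Fin m → 𝔪 := fun i j => ⟨S i j, MvPolynomial.mem_map_C_iff.2 (hSm i j)⟩
    let z := altOfArr (B := MvPolynomial (Fin m) R) s (fun i j => Subtype.ext (hSalt i j))
      (fun i => Subtype.ext (hS0 i))
    choose Q hQm hQ using monicMem f hμ R p hp
    let dg : Fin m → MvPolynomial (Fin m) R := fun i => pderiv i g
    have hz : z.curryLeft dg = 0 := by
      ext1 v
      change ∑ i, ∑ j, (dg i * v 0 j) • s i j = 0
      rw [Finset.sum_comm]
      refine Finset.sum_eq_zero fun j _ => ?_
      apply Subtype.ext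
      have hj := h j
      rw [schFnBiv] at hj
      simp only [s, AddSubmonoidClass.coe_finsetSum, Submodule.coe_smul, smul_eq_mul,
        ZeroMemClass.coe_zero]
      calc _ = v 0 j * ∑ i, S i j * pderiv i g := by
            rw [Finset.mul_sum]
            exact Finset.sum_congr rfl fun i _ => by simp only [dg]; ring
        _ = 0 := by rw [hj, mul_zero]
    obtain ⟨w, hw⟩ := kz_exact (Pi.basisFun (MvPolynomial (Fin m) R) (Fin m)) dg _ 𝔪
      (weaklyReg _ Q hQm) (by
        intro y hy
        obtain ⟨i, rfl⟩ := (List.mem_ofFn' _ _).1 hy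
        obtain ⟨c, hc⟩ := Ideal.mem_span_range_iff_exists_fun.1 (hQ i)
        refine ⟨Fintype.linearCombination _ c, ?_⟩
        refine Eq.trans ?_ hc
        rw [Fintype.linearCombination_apply]
        exact Finset.sum_congr rfl fun i _ => by simp only [dg, smul_eq_mul]; ring) 1
      (by simp) z hz
    let e : Fin m → (Fin m → MvPolynomial (Fin m) R) := fun i => Pi.single i 1
    refine ⟨fun i j l => (w ![e i, e j, e l] : MvPolynomial (Fin m) R), ?_, ?_, ?_⟩
    · intro i j l
      have hsw := alt3_swap w (e i) (e j) (e l)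
      exact ⟨congrArg Subtype.val hsw.1, congrArg Subtype.val hsw.2⟩
    · intro i j l
      exact MvPolynomial.mem_map_C_iff.1 (w ![e i, e j, e l]).2
    · intro j l
      have h1 := congrArg (fun t => t ![e j, e l]) hw
      have h2 : z ![e j, e l] = s j l := by
        change ∑ i, ∑ j', (e j i * e l j') • s i j' = _
        simp [e, Pi.single_apply]
      have h3 : dg = ∑ i, dg i • e i := by
        ext1 a
        simp [e, Pi.single_apply]
      simp only [AlternatingMap.curryLeft_apply_apply] at h1
      rw [h2] at h1
      have h4 : w.curryLeft dg ![e j, e l] = ∑ i, dg i • w ![e i, e j, e l] := by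
        conv_lhs => rw [h3]
        let L : (Fin m → MvPolynomial (Fin m) R) →ₗ[MvPolynomial (Fin m) R] 𝔪 :=
          { toFun := fun x => w.curryLeft x ![e j, e l]
            map_add' := fun x y => by rw [map_add]; rfl
            map_smul' := fun c x => by rw [map_smul]; rfl }
        refine (map_sum L _ _).trans ?_
        refine Finset.sum_congr rfl fun i _ => ?_
        rw [map_smul]
        rfl
      have h5 : S j l = ((s j l : 𝔪) : MvPolynomial (Fin m) R) := rfl
      rw [h5, ← h1, ← AlternatingMap.curryLeft_apply_apply, h4, schFnTriv]
      simp only [AddSubmonoidClass.coe_finsetSum, Submodule.coe_smul, smul_eq_mul]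
      exact Finset.sum_congr rfl fun i _ => mul_comm _ _
  · rintro ⟨T, hT, -, hST⟩ j
    refine eq_zero_of_self_eq_neg K _ ?_
    simp only [schFnBiv, hST, schFnTriv, Finset.sum_mul]
    conv_lhs => rw [Finset.sum_comm]
    rw [← Finset.sum_neg_distrib]
    refine Finset.sum_congr rfl fun a _ => ?_
    rw [← Finset.sum_neg_distrib]
    refine Finset.sum_congr rfl fun b _ => ?_
    rw [(hT a b j).1]; ring
end

section
/- Let k be a field of characteristic zero, A = k[x_1,…,x_n], f ∈ A, and S a bivector field with [f, S] = 0 and [S,S] = 0, and p_1 ∈ A arbitrary. Then [f, [p_1, S]] = 0; consequently, since the Koszul complex (Λ_A T_A, ad_f) is acyclic when f has finite Milnor number, there exists a bivector S_2 with [p_1, S_1] = [f, S_2], i.e., every first-order deformation datum (p_1, S_1) with [f,S_1]=0, [S_1,S_1]=0 extends to second order. -/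
open MvPolynomial

/- Polyvector fields on affine `n`-space in coordinates.  Since `T_A = Der_k(A)` is free on
`∂₁, …, ∂ₙ`, a `p`-vector field is given by its alternating array of coefficients.  The
Schouten–Nijenhuis bracket is given by the classical coordinate formulas below. -/

variable {k : Type*} [CommRing k] {n : ℕ}

namespace KosAux

theorem map_smul_top_mem {R M : Type*} [CommRing R] [AddCommGroup M] [Module R M]
    (J : Ideal R) (L : M →ₗ[R] M) {x : M} (hx : x ∈ J • (⊤ : Submodule R M)) :
    L x ∈ J • (⊤ : Submodule R M) := by
  have h : L x ∈ (J • (⊤ : Submodule R M)).map L := Submodule.mem_map_of_mem hx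
  rw [Submodule.map_smul''] at h
  exact Submodule.smul_mono le_rfl le_top h

theorem mem_smul_top_iff_repr {R M I : Type*} [CommRing R] [AddCommGroup M] [Module R M]
    (b : Module.Basis I R M) (J : Ideal R) (x : M) :
    x ∈ J • (⊤ : Submodule R M) ↔ ∀ i, b.repr x i ∈ J := by
  constructor
  · intro hx i
    have h : b.coord i x ∈ (J • (⊤ : Submodule R M)).map (b.coord i) :=
      Submodule.mem_map_of_mem hx
    rw [Submodule.map_smul''] at h
    refine Submodule.smul_induction_on h ?_ ?_
    · intro r hr n _
      exact J.mul_mem_right _ hr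
    · intro x y hx hy
      exact J.add_mem hx hy
  · intro h
    rw [← b.linearCombination_repr x, Finsupp.linearCombination_apply]
    exact Submodule.sum_mem _ fun i _ => Submodule.smul_mem_smul (h i) trivial

theorem regular_smul_top {R M I : Type*} [CommRing R] [AddCommGroup M] [Module R M]
    (b : Module.Basis I R M) (J : Ideal R) (g : R) (hg : ∀ p, g * p ∈ J → p ∈ J) (x : M)
    (hx : g • x ∈ J • (⊤ : Submodule R M)) : x ∈ J • (⊤ : Submodule R M) := by
  rw [mem_smul_top_iff_repr b] at hx ⊢
  intro i
  apply hg
  simpa using hx i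

theorem extPow_eq_zero {R : Type*} [CommRing R] {m i : ℕ} (hi : m < i)
    (w : ExteriorAlgebra R (Fin m → R)) (hw : w ∈ ⋀[R]^i (Fin m → R)) : w = 0 := by
  have h0 : ExteriorAlgebra.ιMulti R i (M := Fin m → R) = 0 := by
    refine (Pi.basisFun R (Fin m)).ext_alternating fun v hv => ?_
    have := Fintype.card_le_of_injective v hv
    simp at this
    omega
  rw [← ExteriorAlgebra.ιMulti_span_fixedDegree, h0] at hw
  refine Submodule.span_induction ?_ rfl ?_ ?_ hw
  · rintro x ⟨v, rfl⟩; rfl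
  · rintro x y _ _ rfl rfl; simp
  · rintro a x _ rfl; simp

open CliffordAlgebra in
/-- Depth sensitivity of the Koszul complex. -/
theorem koszul_exact {R : Type*} [CommRing R] {m : ℕ}
    (φ : Module.Dual R (Fin m → R)) (g : ℕ → R) (J : ℕ → Ideal R)
    (hJ : ∀ k < m, J (k + 1) = J k ⊔ Ideal.span {g k})
    (hgφ : ∀ k < m, ∃ e, φ e = g k)
    (hreg : ∀ k < m, ∀ p, g k * p ∈ J k → p ∈ J k) (t k : ℕ) (hk : k + t = m) :
    ∀ (w : ExteriorAlgebra R (Fin m → R)), w ∈ ⋀[R]^(k + 1) (Fin m → R) →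
      contractLeft φ w ∈ J k • (⊤ : Submodule R (ExteriorAlgebra R (Fin m → R))) →
      ∃ z, w - contractLeft φ z ∈
        J k • (⊤ : Submodule R (ExteriorAlgebra R (Fin m → R))) := by
  induction t generalizing k with
  | zero =>
    intro w hw _
    have := extPow_eq_zero (by omega) w hw
    exact ⟨0, by simp [this]⟩
  | succ t ih =>
    intro w hw hd
    obtain ⟨e, he⟩ := hgφ k (by omega)
    set u : ExteriorAlgebra R (Fin m → R) := ExteriorAlgebra.ι R e * w with hu
    have hdu : contractLeft φ u = g k • w - ExteriorAlgebra.ι R e * contractLeft φ w := by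
      rw [← he]; exact contractLeft_ι_mul _ _ _
    have hedw : ExteriorAlgebra.ι R e * contractLeft φ w ∈
        J k • (⊤ : Submodule R (ExteriorAlgebra R (Fin m → R))) :=
      map_smul_top_mem (J k) (LinearMap.mulLeft R (ExteriorAlgebra.ι R e)) hd
    have hu2 : u ∈ ⋀[R]^(k + 1 + 1) (Fin m → R) := by
      rw [ExteriorAlgebra.exteriorPower, pow_succ']
      exact Submodule.mul_mem_mul (LinearMap.mem_range_self _ e) hw
    have hle : J k ≤ J (k + 1) := by rw [hJ k (by omega)]; exact le_sup_left
    have hgk : g k ∈ J (k + 1) := by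
      rw [hJ k (by omega)]; exact Ideal.mem_sup_right (Ideal.mem_span_singleton_self _)
    obtain ⟨z, hz⟩ := ih (k + 1) (by omega) u hu2 (by
      rw [hdu]
      exact Submodule.sub_mem _ (Submodule.smul_mem_smul hgk trivial)
        (Submodule.smul_mono_left hle hedw))
    rw [hJ k (by omega), Submodule.sup_smul, Submodule.mem_sup] at hz
    obtain ⟨j, hj, y', hy', hjy⟩ := hz
    rw [Submodule.ideal_span_singleton_smul, Submodule.mem_smul_pointwise_iff_exists] at hy'
    obtain ⟨y, -, rfl⟩ := hy'
    refine ⟨y, regular_smul_top (Pi.basisFun R (Fin m)).ExteriorAlgebra (J k) (g k)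
      (hreg k (by omega)) _ ?_⟩
    have h1 : contractLeft φ u = contractLeft φ j + g k • contractLeft φ y := by
      have h2 : contractLeft φ (j + g k • y) = contractLeft φ (u - contractLeft φ z) := by
        rw [hjy]
      rw [map_add, map_sub, map_smul] at h2
      rw [h2]
      rw [contractLeft_contractLeft (Q := (0 : QuadraticForm R (Fin m → R))) φ z, sub_zero]
    have h3 : g k • (w - contractLeft φ y) =
        contractLeft φ j + ExteriorAlgebra.ι R e * contractLeft φ w := by
      rw [hdu] at h1
      rw [smul_sub, sub_eq_iff_eq_add]
      rw [sub_eq_iff_eq_add] at h1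
      rw [h1]; abel
    rw [h3]
    exact Submodule.add_mem _ (map_smul_top_mem (J k) (contractLeft φ) hj) hedw

open CliffordAlgebra in
theorem koszul_H1 {R : Type*} [CommRing R] {m : ℕ} (f : Fin m → R)
    (g : ℕ → R) (J : ℕ → Ideal R) (hJ0 : J 0 = ⊥)
    (hJ : ∀ k < m, J (k + 1) = J k ⊔ Ideal.span {g k})
    (hgf : ∀ k < m, g k ∈ Ideal.span (Set.range f))
    (hreg : ∀ k < m, ∀ p, g k * p ∈ J k → p ∈ J k)
    (v : Fin m → R) (hv : ∑ i, v i * f i = 0) :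
    ∃ S : Fin m → Fin m → R, (∀ i j, S i j = - S j i) ∧ ∀ j, v j = ∑ i, S i j * f i := by
  let φ : Module.Dual R (Fin m → R) := ∑ i, f i • LinearMap.proj i
  have hφ : ∀ e, φ e = ∑ i, e i * f i := by
    intro e; simp [φ, mul_comm]
  obtain ⟨z, hz⟩ := koszul_exact φ g J hJ (by
      intro k hk
      obtain ⟨c, hc⟩ := (Ideal.mem_span_range_iff_exists_fun).1 (hgf k hk)
      exact ⟨c, by rw [hφ, hc]⟩) hreg m 0 (by omega) (ExteriorAlgebra.ι R v)
      (by simp [ExteriorAlgebra.exteriorPower])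
      (by
        have : contractLeft φ (ExteriorAlgebra.ι R v) =
            algebraMap R (ExteriorAlgebra R (Fin m → R)) (φ v) := contractLeft_ι _ _ _
        rw [this, hφ, hv, map_zero]; exact Submodule.zero_mem _)
  rw [hJ0, Submodule.bot_smul, Submodule.mem_bot, sub_eq_zero] at hz
  let c : ExteriorAlgebra R (Fin m → R) →ₗ[R] R :=
    (ExteriorAlgebra.algebraMapInv (R := R) (M := Fin m → R)).toLinearMap
  let ε : Fin m → Module.Dual R (Fin m → R) := fun i => LinearMap.proj i
  have hφε : φ = ∑ i, f i • ε i := rfl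
  have hcomm : ∀ (a b : Module.Dual R (Fin m → R)) (x : ExteriorAlgebra R (Fin m → R)),
    contractLeft a (contractLeft b x) = - contractLeft b (contractLeft a x) :=
    fun a b x => contractLeft_comm (Q := (0 : QuadraticForm R (Fin m → R))) a b x
  refine ⟨fun i j => c (contractLeft (ε j) (contractLeft (ε i) z)), ?_, ?_⟩
  · intro i j
    show c _ = - c _
    rw [hcomm, map_neg]
  · intro j
    have h1 : c (contractLeft (ε j) (ExteriorAlgebra.ι R v)) = v j := by
      have : contractLeft (ε j) (ExteriorAlgebra.ι R v) =
            algebraMap R (ExteriorAlgebra R (Fin m → R)) (ε j v) := contractLeft_ι _ _ _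
      rw [this]
      exact ExteriorAlgebra.algebraMap_leftInverse _ _
    rw [← h1, hz, hφε]
    simp [map_sum, LinearMap.sum_apply, mul_comm]

theorem regular_aux {K σ : Type*} [Field K] [DecidableEq σ] (q : σ → Polynomial K) (k : σ)
    (hq : (q k).Monic) (s : Set σ) (hk : k ∉ s) (p : MvPolynomial σ K)
    (hp : Polynomial.aeval (X k) (q k) * p ∈
      Ideal.span ((fun i => Polynomial.aeval (X i : MvPolynomial σ K) (q i)) '' s)) :
    p ∈ Ideal.span ((fun i => Polynomial.aeval (X i : MvPolynomial σ K) (q i)) '' s) := by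
  let e : MvPolynomial σ K ≃ₐ[K] Polynomial (MvPolynomial {j // j ≠ k} K) :=
    (renameEquiv K (Equiv.optionSubtypeNe k).symm).trans (optionEquivLeft K _)
  have hek : e (X k) = Polynomial.X := by
    simp [e]
  have hej : ∀ j (h : j ≠ k), e (X j) = Polynomial.C (X ⟨j, h⟩) := by
    intro j h
    simp [e, h]
  have h1 : e (Polynomial.aeval (X k) (q k)) = (q k).map (algebraMap K _) := by
    rw [← Polynomial.aeval_algHom_apply e, hek]
    rw [Polynomial.aeval_X_left_eq_map]
  let J' : Ideal (MvPolynomial {j // j ≠ k} K) :=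
    Ideal.span ((fun i : {j // j ≠ k} => Polynomial.aeval (X i) (q i)) '' {i | i.1 ∈ s})
  have hmap : Ideal.map (e : MvPolynomial σ K →+* _) (Ideal.span
      ((fun i => Polynomial.aeval (X i : MvPolynomial σ K) (q i)) '' s)) =
      Ideal.map Polynomial.C J' := by
    have hX : ∀ j (h : j ≠ k), e (Polynomial.aeval (X j) (q j)) =
        Polynomial.C (Polynomial.aeval (X ⟨j, h⟩) (q j)) := by
      intro j h
      rw [← Polynomial.aeval_algHom_apply e, hej j h]
      exact Polynomial.aeval_algebraMap_apply _ _ _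
    rw [Ideal.map_span, Ideal.map_span]
    congr 1
    ext y
    constructor
    · rintro ⟨_, ⟨j, hj, rfl⟩, rfl⟩
      have h : j ≠ k := fun h => hk (h ▸ hj)
      exact ⟨_, ⟨⟨j, h⟩, hj, rfl⟩, (hX j h).symm⟩
    · rintro ⟨_, ⟨⟨j, h⟩, hj, rfl⟩, rfl⟩
      exact ⟨_, ⟨j, hj, rfl⟩, hX j h⟩
  have hmem : ∀ x, x ∈ Ideal.span
      ((fun i => Polynomial.aeval (X i : MvPolynomial σ K) (q i)) '' s) ↔
      e x ∈ Ideal.map Polynomial.C J' := by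
    intro x
    rw [← hmap]
    constructor
    · intro h; exact Ideal.mem_map_of_mem _ h
    · intro h
      obtain ⟨y, hy, hyx⟩ := (Ideal.mem_map_iff_of_surjective _ e.surjective).1 h
      rwa [← e.injective hyx]
  rw [hmem] at hp ⊢
  rw [map_mul, h1] at hp
  have hker : ∀ x : Polynomial (MvPolynomial {j // j ≠ k} K),
      x ∈ Ideal.map Polynomial.C J' ↔ x.map (Ideal.Quotient.mk J') = 0 := by
    intro x
    rw [Ideal.mem_map_C_iff, Polynomial.ext_iff]
    simp [Polynomial.coeff_map, Ideal.Quotient.eq_zero_iff_mem]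
  rw [hker] at hp ⊢
  rw [Polynomial.map_mul] at hp
  exact (((hq.map _).map _).mul_right_eq_zero_iff).1 hp

theorem exists_monic {K : Type*} [Field K] {m : ℕ} (I : Ideal (MvPolynomial (Fin m) K))
    (h : FiniteDimensional K (MvPolynomial (Fin m) K ⧸ I)) (i : Fin m) :
    ∃ q : Polynomial K, q.Monic ∧ Polynomial.aeval (X i : MvPolynomial (Fin m) K) q ∈ I := by
  obtain ⟨q, hq, h0⟩ := IsIntegral.of_finite K (Ideal.Quotient.mkₐ K I (X i))
  refine ⟨q, hq, ?_⟩
  rw [← Polynomial.aeval_def, Polynomial.aeval_algHom_apply] at h0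
  exact Ideal.Quotient.eq_zero_iff_mem.1 h0

theorem main {K : Type*} [Field K] {m : ℕ} (f : Fin m → MvPolynomial (Fin m) K)
    (h : FiniteDimensional K (MvPolynomial (Fin m) K ⧸ Ideal.span (Set.range f)))
    (v : Fin m → MvPolynomial (Fin m) K) (hv : ∑ i, v i * f i = 0) :
    ∃ S : Fin m → Fin m → MvPolynomial (Fin m) K,
      (∀ i j, S i j = - S j i) ∧ ∀ j, v j = ∑ i, S i j * f i := by
  choose q hq hqI using exists_monic _ h
  let G : Fin m → MvPolynomial (Fin m) K := fun i => Polynomial.aeval (X i) (q i)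
  refine koszul_H1 f (fun k => if hk : k < m then G ⟨k, hk⟩ else 0)
    (fun k => Ideal.span (G '' {i | i.1 < k})) (by simp) ?_ ?_ ?_ v hv
  · intro k hk
    have : {i : Fin m | i.1 < k + 1} = {i | i.1 < k} ∪ {⟨k, hk⟩} := by
      ext i; simp [Fin.ext_iff]; omega
    simp only [this, Set.image_union, Ideal.span_union, Set.image_singleton, hk, dif_pos]
  · intro k hk
    simp only [hk, dif_pos]
    exact hqI _
  · intro k hk p hp
    simp only [hk, dif_pos] at hp
    exact regular_aux q ⟨k, hk⟩ (hq _) _ (by simp) p hp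

end KosAux

/-- Let `k` be a field of characteristic zero, `A = k[x₁,…,xₙ]`, `f ∈ A`,
and `S` a bivector field with `[f, S] = 0` and `[S, S] = 0`, and `p₁ ∈ A` arbitrary.  Then
`[f, [p₁, S]] = 0` (here `[p₁,S]` is the vector field `schFnBiv p₁ S` and the bracket of
`f` with a vector field `v` is `−v(f) = −∑ₗ vₗ ∂ₗf`).  Consequently, if `f` has finite
Milnor number (so that the Koszul complex `(Λ_A T_A, ad_f)` is acyclic), there is a
bivector `S₂` with `[p₁, S] = [f, S₂]` — i.e. every first-order deformation datum extends
to second order. -/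
theorem unfolding_stmt14 (K : Type*) [Field K] [CharZero K] (m : ℕ)
    (f : MvPolynomial (Fin m) K)
    (S : Fin m → Fin m → MvPolynomial (Fin m) K) (hSalt : IsAltBiv S)
    (hfS : ∀ j, schFnBiv f S j = 0)
    (hSS : ∀ i j l, schBivBiv S i j l = 0)
    (p₁ : MvPolynomial (Fin m) K) :
    (∑ l, schFnBiv p₁ S l * pderiv l f = 0) ∧
    (FiniteDimensional K
        (MvPolynomial (Fin m) K ⧸
          Ideal.span (Set.range fun i : Fin m => pderiv i f)) →
      ∃ S₂ : Fin m → Fin m → MvPolynomial (Fin m) K,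
        IsAltBiv S₂ ∧ ∀ j, schFnBiv p₁ S j = schFnBiv f S₂ j) := by
  have h1 : ∑ l, schFnBiv p₁ S l * pderiv l f = 0 := by
    simp only [schFnBiv, Finset.sum_mul]
    rw [Finset.sum_comm]
    refine Finset.sum_eq_zero fun i _ => ?_
    have h2 := hfS i
    simp only [schFnBiv] at h2
    calc ∑ l, S i l * pderiv i p₁ * pderiv l f
        = - pderiv i p₁ * ∑ l, S l i * pderiv l f := by
          rw [Finset.mul_sum]
          refine Finset.sum_congr rfl fun l _ => ?_
          rw [hSalt i l]; ring
      _ = 0 := by rw [h2, mul_zero]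
  exact ⟨h1, fun hfin => KosAux.main (fun i => pderiv i f) hfin _ h1⟩
end
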